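/- The map C ↦ ⟨⟨ℓ(C)⟩⟩, where ⟨⟨ℓ(C)⟩⟩ = {⟨ℓ(C')⟩ : C ⊆ C' ⊆ 𝔠}, is a bijection from the subsets of 𝔠 onto Σ_ℛℛ, and under the renaming ⟨⟨ℓ(C)⟩⟩ ↦ ℓ(C) for each C ⊆ 𝔠, the node constraint 𝒩_ℛℛ of ℛ̄(ℛ(Π)) becomes exactly 𝒩_Π and the hyperedge constraint ℰ_ℛℛ becomes exactly ℰ_Π; in other words, the problem Π is a fixed point of the operation ℛ̄ ∘ ℛ. -/

import Mathlib

open scoped Classical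

/-- `StrEq 𝒞 B A` : the label `A` is at least as strong as the label `B` according to the
constraint `𝒞` (written `B ≤ A`): every configuration of `𝒞` containing `B` remains a
configuration of `𝒞` after replacing one occurrence of `B` by `A`. -/
def StrEq {L : Type*} [DecidableEq L] (𝒞 : Set (Multiset L)) (B A : L) : Prop :=
  ∀ m ∈ 𝒞, B ∈ m → (A ::ₘ m.erase B) ∈ 𝒞

/-- `IsChoice m c` : the multiset `c` is obtained by choosing one element from each of the
sets in the configuration `m`. -/
def IsChoice {L : Type*} (m : Multiset (Set L)) (c : Multiset L) : Prop :=
  Multiset.Rel (fun B a => a ∈ B) m c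

/-- The hyperedge constraint ℰ_Π: the label `ℓ(C)` is identified with the color set
`C ⊆ 𝔠 = {1, …, Δ}` (here `Finset (Fin Δ)`), and a hyperedge configuration is a multiset of
`r` labels `ℓ(C₁) … ℓ(C_r)` such that for each color `i` there is at least one index `j`
with `i ∉ C_j`. -/
def EPi (Δ r : ℕ) : Set (Multiset (Finset (Fin Δ))) :=
  {m | Multiset.card m = r ∧ ∀ i : Fin Δ, ∃ C ∈ m, i ∉ C}

/-- The node constraint 𝒩_Π: the configurations `ℓ(C)^{Δ−|C|+1} ℓ(∅)^{|C|−1}` for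
nonempty `C ⊆ 𝔠`. -/
def NPi (Δ : ℕ) : Set (Multiset (Finset (Fin Δ))) :=
  {m | ∃ C : Finset (Fin Δ), C ≠ ∅ ∧
    m = Multiset.replicate (Δ - C.card + 1) C +
        Multiset.replicate (C.card - 1) (∅ : Finset (Fin Δ))}

/-- `⟨ℓ(C)⟩`, the set of all labels at least as strong as `ℓ(C)` according to ℰ_Π. -/
def genE (Δ r : ℕ) (C : Finset (Fin Δ)) : Set (Finset (Fin Δ)) :=
  {A | StrEq (EPi Δ r) C A}

/-- Configurations `B₁ … B_r` of nonempty subsets of Σ_Π all of whose choices form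
configurations of ℰ_Π. -/
def ECand (Δ r : ℕ) : Set (Multiset (Set (Finset (Fin Δ)))) :=
  {m | Multiset.card m = r ∧ (∀ B ∈ m, B.Nonempty) ∧ ∀ c, IsChoice m c → c ∈ EPi Δ r}

/-- The hyperedge constraint ℰ_ℛ of ℛ(Π): the maximal configurations among `ECand`. -/
def ER (Δ r : ℕ) : Set (Multiset (Set (Finset (Fin Δ)))) :=
  {m | m ∈ ECand Δ r ∧ ∀ m' ∈ ECand Δ r, Multiset.Rel (· ⊆ ·) m m' → m = m'}

/-- The label set Σ_ℛ of ℛ(Π): the subsets of Σ_Π occurring in configurations of ℰ_ℛ. -/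
def SigR (Δ r : ℕ) : Set (Set (Finset (Fin Δ))) :=
  {B | ∃ m ∈ ER Δ r, B ∈ m}

/-- The node constraint 𝒩_ℛ of ℛ(Π): configurations `B₁ … B_Δ` of labels of Σ_ℛ such that
some choice forms a configuration of 𝒩_Π. -/
def NR (Δ r : ℕ) : Set (Multiset (Set (Finset (Fin Δ)))) :=
  {m | Multiset.card m = Δ ∧ (∀ B ∈ m, B ∈ SigR Δ r) ∧ ∃ c, IsChoice m c ∧ c ∈ NPi Δ}

/-- `⟨⟨ℓ(C)⟩⟩ = {⟨ℓ(C')⟩ : C ⊆ C' ⊆ 𝔠}`. -/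
def gen2 (Δ r : ℕ) (C : Finset (Fin Δ)) : Set (Set (Finset (Fin Δ))) :=
  {B | ∃ C' : Finset (Fin Δ), C ⊆ C' ∧ B = genE Δ r C'}

/-- Configurations `Q₁ … Q_Δ` of nonempty subsets of Σ_ℛ all of whose choices form
configurations of 𝒩_ℛ. -/
def NCand (Δ r : ℕ) : Set (Multiset (Set (Set (Finset (Fin Δ))))) :=
  {m | Multiset.card m = Δ ∧ (∀ Q ∈ m, Q.Nonempty ∧ Q ⊆ SigR Δ r) ∧
       ∀ c, IsChoice m c → c ∈ NR Δ r}

/-- The node constraint 𝒩_ℛℛ of ℛ̄(ℛ(Π)): the maximal configurations among `NCand`. -/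
def NRR (Δ r : ℕ) : Set (Multiset (Set (Set (Finset (Fin Δ))))) :=
  {m | m ∈ NCand Δ r ∧ ∀ m' ∈ NCand Δ r, Multiset.Rel (· ⊆ ·) m m' → m = m'}

/-- The label set Σ_ℛℛ of ℛ̄(ℛ(Π)): the subsets of Σ_ℛ occurring in 𝒩_ℛℛ. -/
def SigRR (Δ r : ℕ) : Set (Set (Set (Finset (Fin Δ)))) :=
  {Q | ∃ m ∈ NRR Δ r, Q ∈ m}

/-- The hyperedge constraint ℰ_ℛℛ of ℛ̄(ℛ(Π)): configurations `Q₁ … Q_r` of labels of Σ_ℛℛ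
such that some choice forms a configuration of ℰ_ℛ. -/
def ERR (Δ r : ℕ) : Set (Multiset (Set (Set (Finset (Fin Δ))))) :=
  {m | Multiset.card m = r ∧ (∀ Q ∈ m, Q ∈ SigRR Δ r) ∧ ∃ c, IsChoice m c ∧ c ∈ ER Δ r}

/-- configuration from an indexed family -/
def MM {α : Type*} {n : ℕ} (f : Fin n → α) : Multiset α := (Finset.univ : Finset (Fin n)).val.map f

lemma MM_card {α : Type*} {n : ℕ} (f : Fin n → α) : Multiset.card (MM f) = n := by simp [MM]

lemma mem_MM {α : Type*} {n : ℕ} (f : Fin n → α) (a : α) : a ∈ MM f ↔ ∃ i, f i = a := by simp [MM]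

lemma MM_map {α β : Type*} {n : ℕ} (f : Fin n → α) (h : α → β) :
    (MM f).map h = MM (fun i => h (f i)) := by
  unfold MM; rw [Multiset.map_map]; rfl

lemma exists_MM {α : Type*} {n : ℕ} (m : Multiset α) (h : Multiset.card m = n) :
    ∃ f : Fin n → α, m = MM f := by
  subst h
  induction m using Quotient.inductionOn with
  | h l =>
    refine ⟨fun i => l.get i, ?_⟩
    simp only [MM, Multiset.quot_mk_to_coe]
    congr 1
    exact (List.map_get_finRange l).symm

lemma rel_finset {ι β : Type*} [Nonempty β] (R : ι → β → Prop) (s : Finset ι) :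
    ∀ t : Multiset β, Multiset.Rel R s.val t → ∃ g : ι → β, (∀ a ∈ s, R a (g a)) ∧ t = s.val.map g := by
  induction s using Finset.induction_on with
  | empty =>
    intro t h
    rw [Finset.empty_val, Multiset.rel_zero_left] at h
    exact ⟨fun _ => Classical.arbitrary β, by simp, by simp [h]⟩
  | insert a s ha ih =>
    intro t h
    rw [Finset.insert_val_of_notMem ha, Multiset.rel_cons_left] at h
    obtain ⟨b, t', hb, ht', rfl⟩ := h
    obtain ⟨g, hg, rfl⟩ := ih t' ht'
    refine ⟨Function.update g a b, ?_, ?_⟩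
    · intro x hx
      by_cases hxa : x = a
      · subst hxa; simpa using hb
      · simpa [hxa] using hg x (by simpa [hxa] using hx)
    · rw [Finset.insert_val_of_notMem ha, Multiset.map_cons]
      simp only [Function.update_self]
      congr 1
      apply Multiset.map_congr rfl
      intro x hx
      have : x ≠ a := by rintro rfl; exact ha hx
      simp [this]

lemma rel_MM {α β : Type*} [Nonempty β] {n : ℕ} (R : α → β → Prop) (f : Fin n → α) (t : Multiset β) :
    Multiset.Rel R (MM f) t ↔ ∃ g : Fin n → β, (∀ i, R (f i) (g i)) ∧ t = MM g := by
  unfold MM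
  rw [Multiset.rel_map_left]
  constructor
  · intro h
    obtain ⟨g, hg, rfl⟩ := rel_finset _ _ _ h
    exact ⟨g, fun i => hg i (Finset.mem_univ i), rfl⟩
  · rintro ⟨g, hg, rfl⟩
    rw [Multiset.rel_map_right]
    exact Multiset.rel_refl_of_refl_on fun x _ => hg x

lemma rel_MM_of {α β : Type*} {n : ℕ} (R : α → β → Prop) (f : Fin n → α) (g : Fin n → β)
    (h : ∀ i, R (f i) (g i)) : Multiset.Rel R (MM f) (MM g) := by
  unfold MM
  rw [Multiset.rel_map_left, Multiset.rel_map_right]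
  exact Multiset.rel_refl_of_refl_on fun x _ => h x

lemma MM_ite {α : Type*} {n : ℕ} (S : Finset (Fin n)) (a b : α) :
    MM (fun i => if i ∈ S then a else b) =
      Multiset.replicate S.card a + Multiset.replicate (n - S.card) b := by
  have h : (Finset.univ : Finset (Fin n)).val = S.val + Sᶜ.val := by
    rw [← Finset.union_compl S, ← Finset.disjUnion_eq_union _ _ disjoint_compl_right]
    rfl
  unfold MM
  rw [h, Multiset.map_add]
  congr 1
  · rw [Multiset.map_congr rfl (g := fun _ => a)]
    · simp
    · intro x hx; simp [show x ∈ S from hx]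
  · rw [Multiset.map_congr rfl (g := fun _ => b)]
    · simp [Finset.card_compl]
    · intro x hx
      have := Finset.mem_compl.1 (show x ∈ Sᶜ from hx)
      simp [this]

lemma mem_NPi {Δ : ℕ} (m : Multiset (Finset (Fin Δ))) :
    m ∈ NPi Δ ↔ ∃ C S : Finset (Fin Δ), C.Nonempty ∧ S.card + C.card = Δ + 1 ∧
      m = MM (fun i => if i ∈ S then C else ∅) := by
  have hle : ∀ C : Finset (Fin Δ), C.card ≤ Δ := fun C => by simpa using C.card_le_univ
  constructor
  · rintro ⟨C, hC, rfl⟩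
    have hC' := Finset.nonempty_iff_ne_empty.2 hC
    have h1 := hC'.card_pos
    have h2 := hle C
    obtain ⟨S, -, hS⟩ := Finset.exists_subset_card_eq (s := (Finset.univ : Finset (Fin Δ)))
      (n := Δ - C.card + 1) (by rw [Finset.card_univ, Fintype.card_fin]; omega)
    refine ⟨C, S, hC', by omega, ?_⟩
    rw [MM_ite, hS]
    congr 2
    omega
  · rintro ⟨C, S, hC, h, rfl⟩
    have h1 := hC.card_pos
    have h2 := hle C
    refine ⟨C, hC.ne_empty, ?_⟩
    rw [MM_ite]
    congr 2 <;> omega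

lemma mem_EPi_MM {Δ r : ℕ} (f : Fin r → Finset (Fin Δ)) :
    MM f ∈ EPi Δ r ↔ ∀ x, ∃ j, x ∉ f j := by
  simp only [EPi, Set.mem_ofPred_eq, MM_card, true_and, mem_MM]
  constructor
  · intro h x
    obtain ⟨_, ⟨j, rfl⟩, hj⟩ := h x
    exact ⟨j, hj⟩
  · intro h x
    obtain ⟨j, hj⟩ := h x
    exact ⟨_, ⟨j, rfl⟩, hj⟩

lemma mem_genE {Δ r : ℕ} (hr : 2 ≤ r) (C A : Finset (Fin Δ)) : A ∈ genE Δ r C ↔ A ⊆ C := by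
  constructor
  · intro h x hx
    by_contra hxC
    have := h (C ::ₘ Cᶜ ::ₘ Multiset.replicate (r - 2) Finset.univ) ?_ (by simp)
    · rw [Multiset.erase_cons_head] at this
      obtain ⟨D, hD, hxD⟩ := this.2 x
      simp only [Multiset.mem_cons, Multiset.mem_replicate] at hD
      rcases hD with rfl | rfl | ⟨_, rfl⟩ <;> simp_all
    · refine ⟨by simp; omega, fun i => ?_⟩
      by_cases hi : i ∈ C
      · exact ⟨Cᶜ, by simp, by simpa using hi⟩
      · exact ⟨C, by simp, hi⟩
  · intro h m hm hC
    refine ⟨?_, fun i => ?_⟩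
    · rw [Multiset.card_cons, Multiset.card_erase_add_one hC]; exact hm.1
    · obtain ⟨D, hD, hi⟩ := hm.2 i
      by_cases hDC : D = C
      · subst hDC
        exact ⟨A, by simp, fun hh => hi (h hh)⟩
      · exact ⟨D, by simp [(Multiset.mem_erase_of_ne hDC).2 hD], hi⟩

lemma genE_inj {Δ r : ℕ} (hr : 2 ≤ r) {C D : Finset (Fin Δ)} (h : genE Δ r C = genE Δ r D) :
    C = D := by
  apply Finset.Subset.antisymm
  · rw [← mem_genE hr, ← h, mem_genE hr]
  · rw [← mem_genE hr, h, mem_genE hr]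

lemma genE_mem_gen2 {Δ r : ℕ} (hr : 2 ≤ r) {C D : Finset (Fin Δ)} :
    genE Δ r D ∈ gen2 Δ r C ↔ C ⊆ D := by
  constructor
  · rintro ⟨E, hE, h⟩
    rwa [genE_inj hr h]
  · intro h; exact ⟨D, h, rfl⟩

lemma gen2_subset {Δ r : ℕ} (hr : 2 ≤ r) {C D : Finset (Fin Δ)}
    (h : gen2 Δ r C ⊆ gen2 Δ r D) : D ⊆ C :=
  (genE_mem_gen2 hr).1 (h ((genE_mem_gen2 hr).2 (Finset.Subset.refl C)))

lemma gen2_mono {Δ r : ℕ} {C D : Finset (Fin Δ)} (h : D ⊆ C) : gen2 Δ r C ⊆ gen2 Δ r D := by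
  rintro _ ⟨E, hE, rfl⟩
  exact ⟨E, h.trans hE, rfl⟩

lemma gen2_inj {Δ r : ℕ} (hr : 2 ≤ r) : Function.Injective (gen2 Δ r) := fun _ _ h =>
  Finset.Subset.antisymm (gen2_subset hr h.ge) (gen2_subset hr h.le)

/-- down-closed families -/
lemma ECand_genE {Δ r : ℕ} (hr : 2 ≤ r) (C : Fin r → Finset (Fin Δ)) :
    MM (fun j => genE Δ r (C j)) ∈ ECand Δ r ↔ ∀ x, ∃ j, x ∉ C j := by
  constructor
  · rintro ⟨_, _, h⟩
    rw [← mem_EPi_MM]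
    apply h
    apply rel_MM_of
    intro i
    exact (mem_genE hr _ _).2 (Finset.Subset.refl _)
  · intro h
    refine ⟨MM_card _, ?_, ?_⟩
    · intro B hB
      obtain ⟨i, rfl⟩ := (mem_MM _ _).1 hB
      exact ⟨C i, (mem_genE hr _ _).2 (Finset.Subset.refl _)⟩
    · intro c hc
      obtain ⟨g, hg, rfl⟩ := (rel_MM _ _ _).1 hc
      rw [mem_EPi_MM]
      intro x
      obtain ⟨j, hj⟩ := h x
      exact ⟨j, fun hh => hj ((mem_genE hr _ _).1 (hg j) hh)⟩

lemma ER_of {Δ r : ℕ} (hr : 2 ≤ r) (J : Fin Δ → Fin r) :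
    MM (fun j => genE Δ r (Finset.univ.filter fun i => J i ≠ j)) ∈ ER Δ r := by
  refine ⟨(ECand_genE hr _).2 fun x => ⟨J x, by simp⟩, ?_⟩
  intro m' hm' hrel
  obtain ⟨B, hB, rfl⟩ := (rel_MM _ _ _).1 hrel
  congr 1
  funext j
  apply Set.Subset.antisymm (hB j)
  intro A hA
  rw [mem_genE hr]
  intro x hx
  simp only [Finset.mem_filter, Finset.mem_univ, true_and]
  intro hxj
  have := hm'.2.2 (MM (fun k => if k = j then A else Finset.univ.filter fun i => J i ≠ k)) ?_
  · rw [mem_EPi_MM] at this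
    obtain ⟨k, hk⟩ := this x
    by_cases hkj : k = j
    · simp [hkj, hx] at hk
    · simp only [hkj, if_false, Finset.mem_filter, Finset.mem_univ, true_and, not_not] at hk
      exact hkj (hk.symm.trans hxj)
  · apply rel_MM_of
    intro k
    by_cases hkj : k = j
    · subst hkj; simpa using hA
    · simp only [hkj, if_false]
      exact hB k ((mem_genE hr _ _).2 (Finset.Subset.refl _))

lemma ER_form {Δ r : ℕ} (hr : 2 ≤ r) {m} (hm : m ∈ ER Δ r) :
    ∃ C : Fin r → Finset (Fin Δ), (∀ x, ∃ j, x ∉ C j) ∧ m = MM (fun j => genE Δ r (C j)) := by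
  obtain ⟨B, rfl⟩ := exists_MM m hm.1.1
  let C : Fin r → Finset (Fin Δ) := fun j => Finset.univ.filter fun x => ∃ A ∈ B j, x ∈ A
  have hC : ∀ x, ∃ j, x ∉ C j := by
    intro x
    by_contra! hcon
    have : ∀ j, ∃ A ∈ B j, x ∈ A := fun j => by simpa [C] using hcon j
    choose A hA hx using this
    have := hm.1.2.2 (MM A) (rel_MM_of _ _ _ hA)
    rw [mem_EPi_MM] at this
    obtain ⟨j, hj⟩ := this x
    exact hj (hx j)
  refine ⟨C, hC, hm.2 _ ((ECand_genE hr C).2 hC) (rel_MM_of _ _ _ ?_)⟩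
  intro j A hA
  rw [mem_genE hr]
  intro x hx
  simp only [C, Finset.mem_filter, Finset.mem_univ, true_and]
  exact ⟨A, hA, hx⟩

lemma mem_SigR {Δ r : ℕ} (hr : 2 ≤ r) (B) : B ∈ SigR Δ r ↔ ∃ C, B = genE Δ r C := by
  constructor
  · rintro ⟨m, hm, hB⟩
    obtain ⟨C, -, rfl⟩ := ER_form hr hm
    obtain ⟨j, rfl⟩ := (mem_MM _ _).1 hB
    exact ⟨_, rfl⟩
  · rintro ⟨C, rfl⟩
    refine ⟨_, ER_of hr (fun i => if i ∈ C then ⟨1, by omega⟩ else ⟨0, by omega⟩), ?_⟩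
    rw [mem_MM]
    refine ⟨⟨0, by omega⟩, ?_⟩
    congr 1
    ext x
    by_cases hx : x ∈ C <;> simp [hx]

lemma NR_genE {Δ r : ℕ} (hr : 2 ≤ r) (D : Fin Δ → Finset (Fin Δ)) :
    MM (fun i => genE Δ r (D i)) ∈ NR Δ r ↔
      ∃ C S : Finset (Fin Δ), C.Nonempty ∧ S.card + C.card = Δ + 1 ∧ ∀ i ∈ S, C ⊆ D i := by
  constructor
  · rintro ⟨_, _, c, hc, hN⟩
    obtain ⟨g, hg, rfl⟩ := (rel_MM _ _ _).1 hc
    obtain ⟨C, S, hC, hcard, heq⟩ := (mem_NPi _).1 hN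
    have h1 : S.card ≤ (Finset.univ.filter fun i => C = g i).card := by
      have h2 : Multiset.count C (MM g) = (Finset.univ.filter fun i => C = g i).card := by
        unfold MM
        rw [Multiset.count_map]
        rfl
      rw [← h2, heq, MM_ite, Multiset.count_add, Multiset.count_replicate_self]
      omega
    obtain ⟨S', hS', hc'⟩ := Finset.exists_subset_card_eq h1
    refine ⟨C, S', hC, by omega, fun i hi => ?_⟩
    have := (Finset.mem_filter.1 (hS' hi)).2
    rw [this]
    exact (mem_genE hr _ _).1 (hg i)
  · rintro ⟨C, S, hC, hcard, h⟩
    refine ⟨MM_card _, ?_, MM (fun i => if i ∈ S then C else ∅), ?_, (mem_NPi _).2 ⟨C, S, hC, hcard, rfl⟩⟩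
    · intro B hB
      obtain ⟨i, rfl⟩ := (mem_MM _ _).1 hB
      exact (mem_SigR hr _).2 ⟨_, rfl⟩
    · apply rel_MM_of
      intro i
      rw [mem_genE hr]
      split_ifs with hi
      · exact h i hi
      · simp

lemma NCand_dom {Δ r : ℕ} (hr : 2 ≤ r) (Q : Fin Δ → Set (Set (Finset (Fin Δ))))
    (hQ : MM Q ∈ NCand Δ r) :
    ∃ C S : Finset (Fin Δ), C.Nonempty ∧ S.card + C.card = Δ + 1 ∧
      ∀ i, Q i ⊆ gen2 Δ r (if i ∈ S then C else ∅) := by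
  have hQs : ∀ i, (Q i).Nonempty ∧ Q i ⊆ SigR Δ r := fun i => hQ.2.1 _ ((mem_MM _ _).2 ⟨i, rfl⟩)
  let t : Fin Δ → Finset (Fin Δ) := fun x =>
    Finset.univ.filter fun i => ∃ D, genE Δ r D ∈ Q i ∧ x ∉ D
  by_cases hall : ∀ s : Finset (Fin Δ), s.card ≤ (s.biUnion t).card
  · exfalso
    obtain ⟨f, hf, hft⟩ := (Finset.all_card_le_biUnion_card_iff_exists_injective t).1 hall
    have hbij : Function.Bijective f := Finite.injective_iff_bijective.1 hf
    have : ∀ i, ∃ D, genE Δ r D ∈ Q i ∧ ∀ x, f x = i → x ∉ D := by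
      intro i
      obtain ⟨x, rfl⟩ := hbij.2 i
      obtain ⟨D, hD, hx⟩ := (Finset.mem_filter.1 (hft x)).2
      exact ⟨D, hD, fun y hy => by rwa [hf hy]⟩
    choose D hD hDx using this
    have hNR := hQ.2.2 (MM (fun i => genE Δ r (D i))) (rel_MM_of _ _ _ hD)
    obtain ⟨C, S, hC, hcard, hS⟩ := (NR_genE hr D).1 hNR
    have hsub : C.image f ⊆ Sᶜ := by
      intro i hi
      obtain ⟨x, hx, rfl⟩ := Finset.mem_image.1 hi
      rw [Finset.mem_compl]
      intro hxS
      exact hDx _ x rfl (hS _ hxS hx)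
    have h1 := Finset.card_le_card hsub
    rw [Finset.card_image_of_injective _ hf, Finset.card_compl, Fintype.card_fin] at h1
    have := hC.card_pos
    omega
  · push Not at hall
    obtain ⟨C, hC⟩ := hall
    have hCle : C.card ≤ Δ := by simpa using C.card_le_univ
    have h1 : Δ + 1 - C.card ≤ (C.biUnion t)ᶜ.card := by
      rw [Finset.card_compl, Fintype.card_fin]; omega
    obtain ⟨S, hS, hSc⟩ := Finset.exists_subset_card_eq h1
    refine ⟨C, S, Finset.card_pos.1 (by omega), by omega, fun i B hB => ?_⟩
    obtain ⟨D, rfl⟩ := (mem_SigR hr _).1 ((hQs i).2 hB)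
    rw [genE_mem_gen2 hr]
    split_ifs with hi
    · intro x hx
      by_contra hxD
      apply Finset.mem_compl.1 (hS hi)
      exact Finset.mem_biUnion.2 ⟨x, hx, Finset.mem_filter.2 ⟨Finset.mem_univ _, D, hB, hxD⟩⟩
    · simp

lemma NCand_of {Δ r : ℕ} (hr : 2 ≤ r) (C S : Finset (Fin Δ)) (hC : C.Nonempty)
    (hcard : S.card + C.card = Δ + 1) :
    MM (fun i => gen2 Δ r (if i ∈ S then C else ∅)) ∈ NCand Δ r := by
  refine ⟨MM_card _, ?_, ?_⟩
  · intro Q hQ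
    obtain ⟨i, rfl⟩ := (mem_MM _ _).1 hQ
    refine ⟨⟨_, (genE_mem_gen2 hr).2 (Finset.Subset.refl _)⟩, ?_⟩
    rintro _ ⟨D, -, rfl⟩
    exact (mem_SigR hr _).2 ⟨_, rfl⟩
  · intro c hc
    obtain ⟨g, hg, rfl⟩ := (rel_MM _ _ _).1 hc
    choose D hD hgD using hg
    obtain rfl : g = fun i => genE Δ r (D i) := funext hgD
    rw [NR_genE hr]
    refine ⟨C, S, hC, hcard, fun i hi => ?_⟩
    simpa [hi] using hD i

lemma NRR_iff {Δ r : ℕ} (hr : 2 ≤ r) (m) : m ∈ NRR Δ r ↔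
    ∃ C S : Finset (Fin Δ), C.Nonempty ∧ S.card + C.card = Δ + 1 ∧
      m = MM (fun i => gen2 Δ r (if i ∈ S then C else ∅)) := by
  constructor
  · intro hm
    obtain ⟨Q, rfl⟩ := exists_MM m hm.1.1
    obtain ⟨C, S, hC, hcard, h⟩ := NCand_dom hr Q hm.1
    exact ⟨C, S, hC, hcard, hm.2 _ (NCand_of hr C S hC hcard) (rel_MM_of _ _ _ h)⟩
  · rintro ⟨C, S, hC, hcard, rfl⟩
    refine ⟨NCand_of hr C S hC hcard, fun m' hm' hrel => ?_⟩
    obtain ⟨Q, hQ, rfl⟩ := (rel_MM _ _ _).1 hrel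
    obtain ⟨C', S', hC', hcard', h⟩ := NCand_dom hr Q hm'
    have key : ∀ i ∈ S', i ∈ S ∧ C' ⊆ C := by
      intro i hi
      have := gen2_subset hr ((hQ i).trans (h i))
      rw [if_pos hi] at this
      by_cases hiS : i ∈ S
      · rw [if_pos hiS] at this; exact ⟨hiS, this⟩
      · rw [if_neg hiS] at this
        exact absurd (Finset.subset_empty.1 this) hC'.ne_empty
    have hle : C'.card ≤ Δ := by simpa using C'.card_le_univ
    obtain ⟨i0, hi0⟩ : S'.Nonempty := Finset.card_pos.1 (by omega)
    have hCC := (key i0 hi0).2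
    have hSS : S' ⊆ S := fun i hi => (key i hi).1
    have h1 := Finset.card_le_card hCC
    have h2 := Finset.card_le_card hSS
    obtain rfl := Finset.eq_of_subset_of_card_le hCC (by omega)
    obtain rfl := Finset.eq_of_subset_of_card_le hSS (by omega)
    congr 1
    funext i
    exact Set.Subset.antisymm (hQ i) (h i)

lemma SigRR_eq {Δ r : ℕ} (hΔ : 2 ≤ Δ) (hr : 2 ≤ r) : Set.range (gen2 Δ r) = SigRR Δ r := by
  ext Q
  constructor
  · rintro ⟨C, rfl⟩
    have main : ∀ C : Finset (Fin Δ), C.Nonempty → ∃ S : Finset (Fin Δ), S.card + C.card = Δ + 1 := by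
      intro C hC
      have h1 := hC.card_pos
      have h2 : C.card ≤ Δ := by simpa using C.card_le_univ
      obtain ⟨S, -, hS⟩ := Finset.exists_subset_card_eq (s := (Finset.univ : Finset (Fin Δ)))
        (n := Δ - C.card + 1) (by rw [Finset.card_univ, Fintype.card_fin]; omega)
      exact ⟨S, by omega⟩
    rcases C.eq_empty_or_nonempty with rfl | hC
    · have hu : (Finset.univ : Finset (Fin Δ)).Nonempty := ⟨⟨0, by omega⟩, Finset.mem_univ _⟩
      obtain ⟨S, hS⟩ := main _ hu
      refine ⟨_, (NRR_iff hr _).2 ⟨_, S, hu, hS, rfl⟩, ?_⟩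
      have : ∃ i, i ∉ S := by
        by_contra! hcon
        rw [Finset.eq_univ_iff_forall.2 hcon] at hS
        simp at hS
        omega
      obtain ⟨i, hi⟩ := this
      exact (mem_MM _ _).2 ⟨i, by simp [hi]⟩
    · obtain ⟨S, hS⟩ := main _ hC
      refine ⟨_, (NRR_iff hr _).2 ⟨C, S, hC, hS, rfl⟩, ?_⟩
      have h2 : C.card ≤ Δ := by simpa using C.card_le_univ
      obtain ⟨i, hi⟩ : S.Nonempty := Finset.card_pos.1 (by omega)
      exact (mem_MM _ _).2 ⟨i, by simp [hi]⟩
  · rintro ⟨m, hm, hQ⟩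
    obtain ⟨C, S, -, -, rfl⟩ := (NRR_iff hr _).1 hm
    obtain ⟨i, rfl⟩ := (mem_MM _ _).1 hQ
    exact ⟨_, rfl⟩

lemma ERR_eq {Δ r : ℕ} (hΔ : 2 ≤ Δ) (hr : 2 ≤ r) :
    ERR Δ r = (fun m => Multiset.map (gen2 Δ r) m) '' EPi Δ r := by
  ext m
  constructor
  · rintro ⟨hcard, hS, c, hc, hER⟩
    obtain ⟨Q, rfl⟩ := exists_MM m hcard
    have : ∀ j, ∃ C, gen2 Δ r C = Q j := fun j => by
      have := hS (Q j) ((mem_MM _ _).2 ⟨j, rfl⟩)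
      rwa [← SigRR_eq hΔ hr] at this
    choose C hC using this
    obtain rfl : (fun j => gen2 Δ r (C j)) = Q := funext hC
    obtain ⟨g, hg, rfl⟩ := (rel_MM _ _ _).1 hc
    choose D hD hgD using hg
    obtain rfl : g = fun i => genE Δ r (D i) := funext hgD
    have h := (ECand_genE hr D).1 hER.1
    refine ⟨MM C, ?_, MM_map _ _⟩
    rw [mem_EPi_MM]
    intro x
    obtain ⟨j, hj⟩ := h x
    exact ⟨j, fun hh => hj (hD j hh)⟩
  · rintro ⟨c, hc, rfl⟩
    obtain ⟨C, rfl⟩ := exists_MM c hc.1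
    rw [mem_EPi_MM] at hc
    choose J hJ using hc
    simp only [MM_map]
    refine ⟨MM_card _, ?_, _, ?_, ER_of hr J⟩
    · intro Q hQ
      obtain ⟨i, rfl⟩ := (mem_MM _ _).1 hQ
      rw [← SigRR_eq hΔ hr]
      exact ⟨_, rfl⟩
    · apply rel_MM_of
      intro j
      rw [genE_mem_gen2 hr]
      intro x hx
      simp only [Finset.mem_filter, Finset.mem_univ, true_and]
      rintro rfl
      exact hJ x hx

lemma NRR_eq {Δ r : ℕ} (hr : 2 ≤ r) :
    NRR Δ r = (fun m => Multiset.map (gen2 Δ r) m) '' NPi Δ := by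
  ext m
  rw [NRR_iff hr]
  constructor
  · rintro ⟨C, S, hC, hcard, rfl⟩
    exact ⟨_, (mem_NPi _).2 ⟨C, S, hC, hcard, rfl⟩, MM_map _ _⟩
  · rintro ⟨c, hc, rfl⟩
    obtain ⟨C, S, hC, hcard, rfl⟩ := (mem_NPi _).1 hc
    exact ⟨C, S, hC, hcard, MM_map _ _⟩

/-- The map `C ↦ ⟨⟨ℓ(C)⟩⟩` is a bijection from the subsets of `𝔠` onto Σ_ℛℛ, and under the
renaming `⟨⟨ℓ(C)⟩⟩ ↦ ℓ(C)` the node constraint 𝒩_ℛℛ becomes exactly 𝒩_Π and the hyperedge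
constraint ℰ_ℛℛ becomes exactly ℰ_Π: the problem Π is a fixed point of ℛ̄ ∘ ℛ. -/
theorem stmt_7 (Δ r : ℕ) (hΔ : 2 ≤ Δ) (hr : 2 ≤ r) :
    Function.Injective (gen2 Δ r) ∧
    Set.range (gen2 Δ r) = SigRR Δ r ∧
    NRR Δ r = (fun m => Multiset.map (gen2 Δ r) m) '' NPi Δ ∧
    ERR Δ r = (fun m => Multiset.map (gen2 Δ r) m) '' EPi Δ r := by
  exact ⟨gen2_inj hr, SigRR_eq hΔ hr, NRR_eq hr, ERR_eq hΔ hr⟩
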